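/- Fix 0 < α < 1 and a ≥ 2^α(2+α)/(1−α). For every m ≥ 1, every sequence β₁, …, β_m ∈ (0, α], and every x ∈ [0,1], the concatenation of transfer operators applied to the constant function 1 satisfies (P_{β_m} ∘ ⋯ ∘ P_{β_1}) 1(x) ≥ min{a, [α(1+α)/a^α]^{1/(1−α)}}. -/

import Mathlib

open MeasureTheory Set

/-- The Pomeau–Manneville type map `T_β` on `[0,1]` (identified with the circle `S¹`):
`T_β x = x + 3^β/2^(1+β) x^(1+β)` for `x ≤ 2/3` and `T_β x = 3x - 2` otherwise. -/
noncomputable def Tmap (β x : ℝ) : ℝ :=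
  if x ≤ 2/3 then x + (3:ℝ)^β / 2^(1+β) * x^(1+β) else 3*x - 2

/-- The derivative of `T_β` (left-branch formula at `x ≤ 2/3`). -/
noncomputable def Tderiv (β x : ℝ) : ℝ :=
  if x ≤ 2/3 then 1 + (3:ℝ)^β / 2^(1+β) * (1+β) * x^β else 3

/-- The second derivative of `T_β`. -/
noncomputable def Tderiv2 (β x : ℝ) : ℝ :=
  if x ≤ 2/3 then (3:ℝ)^β / 2^(1+β) * (1+β) * β * x^(β-1) else 0

/-- The inverse of the left branch of `T_β` (for `x ∈ [0,1]` this is the unique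
`y ∈ [0,2/3]` with `T_β y = x`). -/
noncomputable def leftInv (β x : ℝ) : ℝ :=
  sSup {y : ℝ | y ∈ Set.Icc (0:ℝ) (2/3) ∧ Tmap β y ≤ x}

/-- The Perron–Frobenius transfer operator of `T_β` with respect to Lebesgue measure:
`P_β f (x) = ∑_{y ∈ T_β⁻¹ x} f y / T_β' y`; the right branch preimage of `x` is `(x+2)/3`,
where the derivative is `3`. -/
noncomputable def Pop (β : ℝ) (f : ℝ → ℝ) (x : ℝ) : ℝ :=
  f (leftInv β x) / Tderiv β (leftInv β x) + f ((x+2)/3) / 3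

/-- `P_{β_{k+n}} ∘ ⋯ ∘ P_{β_{k+1}}`. -/
noncomputable def PopCompFrom (β : ℕ → ℝ) (k : ℕ) : ℕ → (ℝ → ℝ) → ℝ → ℝ
  | 0, f => f
  | n+1, f => Pop (β (k+n+1)) (PopCompFrom β k n f)

/-- `P_{β_n} ∘ ⋯ ∘ P_{β_1}`. -/
noncomputable def PopComp (β : ℕ → ℝ) (n : ℕ) : (ℝ → ℝ) → ℝ → ℝ :=
  PopCompFrom β 0 n

/-- `T_{β_{k+n}} ∘ ⋯ ∘ T_{β_{k+1}}`. -/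
noncomputable def TcompFrom (β : ℕ → ℝ) (k : ℕ) : ℕ → ℝ → ℝ
  | 0, x => x
  | n+1, x => Tmap (β (k+n+1)) (TcompFrom β k n x)

/-- The derivative `(T_{β_{k+n}} ∘ ⋯ ∘ T_{β_{k+1}})'(z)`, computed as the product of the
derivatives along the orbit of `z`. -/
noncomputable def DcompFrom (β : ℕ → ℝ) (k n : ℕ) (z : ℝ) : ℝ :=
  ∏ i ∈ Finset.range n, Tderiv (β (k+i+1)) (TcompFrom β k i z)

/-- The averaging operator `A_ε f (x) = (1/(2ε)) ∫_{B_ε(x)} f dm` on the circle,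
realized via the 1-periodic extension of `f`. -/
noncomputable def Aop (ε : ℝ) (f : ℝ → ℝ) (x : ℝ) : ℝ :=
  (1/(2*ε)) * ∫ t in (x-ε)..(x+ε), f (Int.fract t)

/-- The indicator function of the ball `B_ε(z)` of radius `ε` around `z` in the circle `ℝ/ℤ`. -/
noncomputable def ballInd (ε z : ℝ) : ℝ → ℝ :=
  Set.indicator {y : ℝ | ∃ k : ℤ, |y - z - (k:ℝ)| < ε} (fun _ => 1)

/-- The cone `C₁ = {f ∈ C⁰((0,1]) : f ≥ 0, f decreasing, x ↦ x^(α+1) f x increasing}`. -/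
def memC1 (α : ℝ) (f : ℝ → ℝ) : Prop :=
  ContinuousOn f (Set.Ioc 0 1) ∧ (∀ x ∈ Set.Ioc (0:ℝ) 1, 0 ≤ f x) ∧
  AntitoneOn f (Set.Ioc 0 1) ∧ MonotoneOn (fun x : ℝ => x^(α+1) * f x) (Set.Ioc 0 1)

/-- `m(f) = ∫₀¹ f dm` (Lebesgue). -/
noncomputable def mInt (f : ℝ → ℝ) : ℝ := ∫ x in Set.Ioc (0:ℝ) 1, f x

/-- The cone `C₂ = {f ∈ C₁ ∩ L¹(m) : f x ≤ a x^(-α) m(f)}`. -/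
def memC2 (α a : ℝ) (f : ℝ → ℝ) : Prop :=
  memC1 α f ∧ IntegrableOn f (Set.Ioc 0 1) volume ∧
  ∀ x ∈ Set.Ioc (0:ℝ) 1, f x ≤ a * x^(-α) * mInt f

/-- The `L¹(m)` norm on `[0,1]`. -/
noncomputable def L1norm (f : ℝ → ℝ) : ℝ := ∫ x in Set.Ioc (0:ℝ) 1, |f x|

/-- The `C¹` norm `‖f‖_∞ + ‖f'‖_∞` on the circle. -/
noncomputable def C1norm (f : ℝ → ℝ) : ℝ :=
  (⨆ x : Set.Icc (0:ℝ) 1, |f (x:ℝ)|) + ⨆ x : Set.Icc (0:ℝ) 1, |deriv f (x:ℝ)|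

/-- The relative excess `T_β x / x - 1 = (3x/2)^β / 2` on the left branch. -/
noncomputable def excess (β x : ℝ) : ℝ := (3 * x / 2) ^ β / 2

lemma excess_eq {β x : ℝ} (hx : 0 ≤ x) :
    (3:ℝ) ^ β / 2 ^ (1 + β) * x ^ β = excess β x := by
  unfold excess
  rw [Real.div_rpow (by positivity) (by norm_num), Real.mul_rpow (by norm_num) hx,
    Real.rpow_add (by norm_num), Real.rpow_one]
  field_simp

lemma excess_nonneg {β x : ℝ} (hx : 0 ≤ x) : 0 ≤ excess β x := by
  unfold excess; positivity

lemma excess_le {β x : ℝ} (hβ : 0 < β) (hx : x ∈ Icc (0:ℝ) (2/3)) : excess β x ≤ 1/2 := by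
  unfold excess
  have : (3 * x / 2) ^ β ≤ 1 :=
    Real.rpow_le_one (by linarith [hx.1]) (by linarith [hx.2]) hβ.le
  linarith

lemma excess_mono {β x y : ℝ} (hβ : 0 < β) (hx : 0 ≤ x) (hxy : x ≤ y) :
    excess β x ≤ excess β y := by
  unfold excess
  have : (3 * x / 2) ^ β ≤ (3 * y / 2) ^ β :=
    Real.rpow_le_rpow (by linarith) (by linarith) hβ.le
  linarith

lemma excess_two_thirds (β : ℝ) : excess β (2/3) = 1/2 := by
  unfold excess; norm_num

lemma Tmap_eq {β x : ℝ} (hβ : 0 < β) (hx : x ∈ Icc (0:ℝ) (2/3)) :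
    Tmap β x = x * (1 + excess β x) := by
  rw [Tmap, if_pos hx.2, ← excess_eq hx.1, Real.rpow_one_add' hx.1 (by linarith)]
  ring

lemma Tderiv_eq {β x : ℝ} (hx : x ∈ Icc (0:ℝ) (2/3)) :
    Tderiv β x = 1 + (1 + β) * excess β x := by
  rw [Tderiv, if_pos hx.2, ← excess_eq hx.1]
  ring

lemma one_le_Tderiv {β x : ℝ} (hβ : 0 < β) (hx : x ∈ Icc (0:ℝ) (2/3)) : 1 ≤ Tderiv β x := by
  rw [Tderiv_eq hx]
  nlinarith [excess_nonneg (β := β) hx.1]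

lemma Tmap_strictMonoOn {β : ℝ} (hβ : 0 < β) : StrictMonoOn (Tmap β) (Icc 0 (2/3)) := by
  intro x hx y hy hxy
  rw [Tmap_eq hβ hx, Tmap_eq hβ hy]
  nlinarith [excess_nonneg (β := β) hx.1, excess_mono hβ hx.1 hxy.le, hx.1]

lemma Tmap_zero {β : ℝ} (hβ : 0 < β) : Tmap β 0 = 0 := by
  rw [Tmap_eq hβ ⟨le_rfl, by norm_num⟩, zero_mul]

lemma Tmap_two_thirds {β : ℝ} (hβ : 0 < β) : Tmap β (2/3) = 1 := by
  rw [Tmap_eq hβ ⟨by norm_num, le_rfl⟩, excess_two_thirds]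
  norm_num

lemma Tmap_hasDerivWithinAt {β x : ℝ} (hβ : 0 < β) (hx : x ∈ Icc (0:ℝ) (2/3)) :
    HasDerivWithinAt (Tmap β) (Tderiv β x) (Icc 0 (2/3)) x := by
  have h : HasDerivAt (fun x : ℝ => x + (3:ℝ) ^ β / 2 ^ (1 + β) * x ^ (1 + β))
      (1 + (3:ℝ) ^ β / 2 ^ (1 + β) * ((1 + β) * x ^ (1 + β - 1))) x :=
    (hasDerivAt_id x).add
      ((Real.hasDerivAt_rpow_const (Or.inr (by linarith))).const_mul _)
  have he : Tderiv β x = 1 + (3:ℝ) ^ β / 2 ^ (1 + β) * ((1 + β) * x ^ (1 + β - 1)) := by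
    rw [Tderiv, if_pos hx.2, add_sub_cancel_left]
    ring
  rw [he]
  refine h.hasDerivWithinAt.congr (fun y hy => ?_) ?_
  · rw [Tmap, if_pos hy.2]
  · rw [Tmap, if_pos hx.2]

lemma leftInv_Tmap {β y : ℝ} (hβ : 0 < β) (hy : y ∈ Icc (0:ℝ) (2/3)) :
    leftInv β (Tmap β y) = y := by
  have : {z : ℝ | z ∈ Icc (0:ℝ) (2/3) ∧ Tmap β z ≤ Tmap β y} = Icc 0 y := by
    ext z
    constructor
    · rintro ⟨hz, h⟩
      exact ⟨hz.1, ((Tmap_strictMonoOn hβ).le_iff_le hz hy).1 h⟩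
    · intro hz
      have hz' : z ∈ Icc (0:ℝ) (2/3) := ⟨hz.1, hz.2.trans hy.2⟩
      exact ⟨hz', ((Tmap_strictMonoOn hβ).le_iff_le hz' hy).2 hz.2⟩
  rw [leftInv, this, csSup_Icc hy.1]

lemma Tmap_image {β y : ℝ} (hβ : 0 < β) (hy : y ∈ Icc (0:ℝ) (2/3)) :
    Tmap β '' Icc 0 y = Icc 0 (Tmap β y) := by
  have hsub : Icc (0:ℝ) y ⊆ Icc 0 (2/3) := Icc_subset_Icc_right hy.2
  have hc : ContinuousOn (Tmap β) (Icc 0 y) := fun x hx =>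
    (Tmap_hasDerivWithinAt hβ (hsub hx)).continuousWithinAt.mono hsub
  apply Subset.antisymm
  · rintro _ ⟨x, hx, rfl⟩
    have hm := (Tmap_strictMonoOn hβ).monotoneOn
    refine ⟨?_, hm (hsub hx) hy hx.2⟩
    have := hm ⟨le_rfl, by norm_num⟩ (hsub hx) hx.1
    rwa [Tmap_zero hβ] at this
  · have := intermediate_value_Icc hy.1 hc
    rwa [Tmap_zero hβ] at this

lemma exists_Tmap_eq {β x : ℝ} (hβ : 0 < β) (hx : x ∈ Icc (0:ℝ) 1) :
    ∃ y ∈ Icc (0:ℝ) (2/3), Tmap β y = x := by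
  have h := Tmap_image hβ (y := 2/3) ⟨by norm_num, le_rfl⟩
  rw [Tmap_two_thirds hβ] at h
  rwa [← h] at hx

lemma leftInv_one {β : ℝ} (hβ : 0 < β) : leftInv β 1 = 2/3 := by
  rw [← Tmap_two_thirds hβ, leftInv_Tmap hβ ⟨by norm_num, le_rfl⟩]

lemma Pop_antitoneOn {β : ℝ} (hβ : 0 < β) {f : ℝ → ℝ} (hf : AntitoneOn f (Icc 0 1))
    (h0 : ∀ x ∈ Icc (0:ℝ) 1, 0 ≤ f x) : AntitoneOn (Pop β f) (Icc 0 1) := by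
  intro x hx x' hx' hxx
  obtain ⟨y, hy, rfl⟩ := exists_Tmap_eq hβ hx
  obtain ⟨y', hy', rfl⟩ := exists_Tmap_eq hβ hx'
  have hyy : y ≤ y' := ((Tmap_strictMonoOn hβ).le_iff_le hy hy').1 hxx
  rw [Pop, Pop, leftInv_Tmap hβ hy, leftInv_Tmap hβ hy']
  have hy1 : y ∈ Icc (0:ℝ) 1 := ⟨hy.1, by linarith [hy.2]⟩
  have hy1' : y' ∈ Icc (0:ℝ) 1 := ⟨hy'.1, by linarith [hy'.2]⟩
  have hT : Tderiv β y ≤ Tderiv β y' := by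
    rw [Tderiv_eq hy, Tderiv_eq hy']
    nlinarith [excess_mono hβ hy.1 hyy]
  have h1 : f y' / Tderiv β y' ≤ f y / Tderiv β y :=
    div_le_div₀ (h0 y hy1) (hf hy1 hy1' hyy) (by linarith [one_le_Tderiv hβ hy]) hT
  have h2 : f ((Tmap β y' + 2) / 3) ≤ f ((Tmap β y + 2) / 3) :=
    hf ⟨by linarith [hx.1], by linarith [hx.2]⟩ ⟨by linarith [hx'.1], by linarith [hx'.2]⟩
      (by linarith)
  linarith

lemma Pop_nonneg {β : ℝ} (hβ : 0 < β) {f : ℝ → ℝ} (h0 : ∀ x ∈ Icc (0:ℝ) 1, 0 ≤ f x) :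
    ∀ x ∈ Icc (0:ℝ) 1, 0 ≤ Pop β f x := by
  intro x hx
  obtain ⟨y, hy, rfl⟩ := exists_Tmap_eq hβ hx
  rw [Pop, leftInv_Tmap hβ hy]
  have h1 := h0 y ⟨hy.1, by linarith [hy.2]⟩
  have h2 := h0 ((Tmap β y + 2) / 3) ⟨by linarith [hx.1], by linarith [hx.2]⟩
  have h3 := one_le_Tderiv hβ hy
  positivity

lemma intervalIntegrable_of_antitoneOn {f : ℝ → ℝ} (hf : AntitoneOn f (Icc 0 1)) {s t : ℝ}
    (hs : s ∈ Icc (0:ℝ) 1) (ht : t ∈ Icc (0:ℝ) 1) : IntervalIntegrable f volume s t :=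
  (hf.mono (uIcc_subset_Icc hs ht)).intervalIntegrable

lemma integral_Pop {β : ℝ} (hβ : 0 < β) {f : ℝ → ℝ} (hf : AntitoneOn f (Icc 0 1))
    (h0 : ∀ x ∈ Icc (0:ℝ) 1, 0 ≤ f x) {y : ℝ} (hy : y ∈ Icc (0:ℝ) (2/3)) :
    ∫ x in (0:ℝ)..(Tmap β y), Pop β f x =
      (∫ x in (0:ℝ)..y, f x) + ∫ x in (2/3:ℝ)..((Tmap β y + 2) / 3), f x := by
  have himg := Tmap_image hβ hy
  have hsub : Icc (0:ℝ) y ⊆ Icc 0 (2/3) := Icc_subset_Icc_right hy.2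
  have ht : Tmap β y ∈ Icc (0:ℝ) 1 := by
    have hm := (Tmap_strictMonoOn hβ).monotoneOn
    constructor
    · have := hm ⟨le_rfl, by norm_num⟩ hy hy.1
      rwa [Tmap_zero hβ] at this
    · have := hm hy ⟨by norm_num, le_rfl⟩ hy.2
      rwa [Tmap_two_thirds hβ] at this
  have hright : ∫ x in (0:ℝ)..(Tmap β y), f ((x + 2) / 3) / 3 =
      ∫ x in (2/3:ℝ)..((Tmap β y + 2) / 3), f x := by
    have := intervalIntegral.integral_comp_div_add (a := 0) (b := Tmap β y) f
      (c := 3) (by norm_num) (2/3)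
    rw [intervalIntegral.integral_div]
    simp_rw [add_div]
    rw [this]
    simp
  have hleft : ∫ x in (0:ℝ)..(Tmap β y), f (leftInv β x) / Tderiv β (leftInv β x) =
      ∫ x in (0:ℝ)..y, f x := by
    rw [intervalIntegral.integral_of_le ht.1, intervalIntegral.integral_of_le hy.1,
      ← integral_Icc_eq_integral_Ioc, ← integral_Icc_eq_integral_Ioc, ← himg,
      integral_image_eq_integral_abs_deriv_smul measurableSet_Icc
        (fun x hx => (Tmap_hasDerivWithinAt hβ (hsub hx)).mono hsub)
        ((Tmap_strictMonoOn hβ).injOn.mono hsub)]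
    refine setIntegral_congr_fun measurableSet_Icc fun x hx => ?_
    have h1 := one_le_Tderiv hβ (hsub hx)
    simp only [leftInv_Tmap hβ (hsub hx), smul_eq_mul]
    rw [abs_of_nonneg (by linarith)]
    field_simp
  have hi2 : IntervalIntegrable (fun x => f ((x + 2) / 3) / 3) volume 0 (Tmap β y) := by
    apply AntitoneOn.intervalIntegrable
    intro x hx x' hx' hxx
    rw [uIcc_of_le ht.1] at hx hx'
    have := hf (a := (x + 2) / 3) (b := (x' + 2) / 3)
      ⟨by linarith [hx.1], by linarith [hx.2, ht.2]⟩
      ⟨by linarith [hx'.1], by linarith [hx'.2, ht.2]⟩ (by linarith)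
    simp only
    linarith
  have hi : IntervalIntegrable (Pop β f) volume 0 (Tmap β y) :=
    intervalIntegrable_of_antitoneOn (Pop_antitoneOn hβ hf h0) ⟨le_rfl, zero_le_one⟩ ht
  have hi1 : IntervalIntegrable (fun x => f (leftInv β x) / Tderiv β (leftInv β x)) volume
      0 (Tmap β y) := by
    refine (hi.sub hi2).congr fun x _ => ?_
    simp [Pop]
  rw [← hleft, ← hright, ← intervalIntegral.integral_add hi1 hi2]
  rfl

lemma Pop_weight_monotoneOn {α β : ℝ} (hβ : 0 < β) (hβα : β ≤ α) {f : ℝ → ℝ}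
    (h0 : ∀ x ∈ Icc (0:ℝ) 1, 0 ≤ f x)
    (hm : MonotoneOn (fun x => x ^ (1 + α) * f x) (Icc 0 1)) :
    MonotoneOn (fun x => x ^ (1 + α) * Pop β f x) (Icc 0 1) := by
  intro x hx x' hx' hxx
  obtain ⟨y, hy, rfl⟩ := exists_Tmap_eq hβ hx
  obtain ⟨y', hy', rfl⟩ := exists_Tmap_eq hβ hx'
  have hyy : y ≤ y' := ((Tmap_strictMonoOn hβ).le_iff_le hy hy').1 hxx
  have hy1 : y ∈ Icc (0:ℝ) 1 := ⟨hy.1, by linarith [hy.2]⟩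
  have hy1' : y' ∈ Icc (0:ℝ) 1 := ⟨hy'.1, by linarith [hy'.2]⟩
  simp only [Pop, leftInv_Tmap hβ hy, leftInv_Tmap hβ hy', mul_add]
  refine add_le_add ?_ ?_
  · rw [Tderiv_eq hy, Tderiv_eq hy', Tmap_eq hβ hy, Tmap_eq hβ hy']
    have hu := excess_nonneg (β := β) hy.1
    have hv := excess_mono hβ hy.1 hyy
    set u := excess β y
    set v := excess β y'
    have hv0 : 0 ≤ v := hu.trans hv
    rw [Real.mul_rpow hy.1 (by linarith), Real.mul_rpow hy'.1 (by linarith)]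
    have hbern : (1 + (1 + β) * v) / (1 + (1 + β) * u) ≤ ((1 + v) / (1 + u)) ^ (1 + α) := by
      have h1 : (1 + v) / (1 + u) = 1 + (v - u) / (1 + u) := by field_simp; ring
      have h2 : 0 ≤ (v - u) / (1 + u) := div_nonneg (by linarith) (by linarith)
      have h3 := one_add_mul_self_le_rpow_one_add (s := (v - u) / (1 + u)) (by linarith)
        (p := 1 + α) (by linarith)
      rw [h1]
      refine le_trans ?_ h3
      have h4 : (1 + (1 + β) * v) / (1 + (1 + β) * u)
          = 1 + (1 + β) * ((v - u) / (1 + (1 + β) * u)) := by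
        have : 0 < 1 + (1 + β) * u := by positivity
        field_simp; ring
      rw [h4]
      have h5 : (v - u) / (1 + (1 + β) * u) ≤ (v - u) / (1 + u) :=
        div_le_div_of_nonneg_left (by linarith) (by linarith) (by nlinarith)
      nlinarith
    rw [Real.div_rpow (by linarith) (by linarith), div_le_div_iff₀ (by positivity)
      (by positivity)] at hbern
    have hf := hm hy1 hy1' hyy
    simp only at hf
    have hA : 0 ≤ y ^ (1 + α) * f y := mul_nonneg (Real.rpow_nonneg hy.1 _) (h0 y hy1)
    rw [← mul_div_assoc, ← mul_div_assoc, div_le_div_iff₀ (by positivity) (by positivity)]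
    calc y ^ (1 + α) * (1 + u) ^ (1 + α) * f y * (1 + (1 + β) * v)
        = (y ^ (1 + α) * f y) * ((1 + (1 + β) * v) * (1 + u) ^ (1 + α)) := by ring
      _ ≤ (y' ^ (1 + α) * f y') * ((1 + v) ^ (1 + α) * (1 + (1 + β) * u)) :=
          mul_le_mul hf hbern (by positivity) (hA.trans hf)
      _ = y' ^ (1 + α) * (1 + v) ^ (1 + α) * f y' * (1 + (1 + β) * u) := by ring
  · set z := Tmap β y
    set z' := Tmap β y'
    have hw : (z + 2) / 3 ∈ Icc (0:ℝ) 1 := ⟨by linarith [hx.1], by linarith [hx.2]⟩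
    have hw' : (z' + 2) / 3 ∈ Icc (0:ℝ) 1 := ⟨by linarith [hx'.1], by linarith [hx'.2]⟩
    have hf := hm hw hw' (by linarith)
    simp only at hf
    have hwp : 0 < (z + 2) / 3 := by linarith [hx.1]
    have hwp' : 0 < (z' + 2) / 3 := by linarith [hx'.1]
    have hr : (z / ((z + 2) / 3)) ^ (1 + α) ≤ (z' / ((z' + 2) / 3)) ^ (1 + α) := by
      refine Real.rpow_le_rpow (div_nonneg hx.1 hwp.le) ?_ (by linarith)
      rw [div_le_div_iff₀ hwp hwp']
      nlinarith [hx.1]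
    have hA : 0 ≤ ((z + 2) / 3) ^ (1 + α) * f ((z + 2) / 3) :=
      mul_nonneg (Real.rpow_nonneg hwp.le _) (h0 _ hw)
    have key : ∀ s w : ℝ, 0 ≤ s → 0 < w →
        s ^ (1 + α) * (f w / 3) = (s / w) ^ (1 + α) * (w ^ (1 + α) * f w) / 3 := by
      intro s w hs hw
      have := Real.rpow_pos_of_pos hw (1 + α)
      rw [Real.div_rpow hs hw.le]
      field_simp
    rw [key z _ hx.1 hwp, key z' _ hx'.1 hwp']
    refine div_le_div_of_nonneg_right ?_ (by norm_num)
    exact mul_le_mul hr hf hA (Real.rpow_nonneg (div_nonneg hx'.1 hwp'.le) _)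

lemma mul_rpow_le_mul_rpow {α a : ℝ} (hα0 : 0 < α) (hα1 : α < 1)
    (ha : (2:ℝ) ^ α * (2 + α) / (1 - α) ≤ a) :
    (2/3 : ℝ) ^ (1 - α) * (1 + α) * (9/8 : ℝ) ^ α ≤ (1 - α) * a ^ α := by
  have hγ : 0 < 1 - α := by linarith
  have ha0 : 0 < (2:ℝ) ^ α * (2 + α) / (1 - α) := by positivity
  have hapos : 0 < a := ha0.trans_le ha
  have hloga : α * Real.log 2 + Real.log (2 + α) - Real.log (1 - α) ≤ Real.log a := by
    have := Real.log_le_log ha0 ha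
    rwa [Real.log_div (by positivity) hγ.ne', Real.log_mul (by positivity) (by positivity),
      Real.log_rpow (by norm_num)] at this
  rw [← Real.log_le_log_iff (by positivity) (by positivity),
    Real.log_mul (by positivity) (by positivity), Real.log_mul (by positivity) (by positivity),
    Real.log_mul hγ.ne' (by positivity), Real.log_rpow (by norm_num), Real.log_rpow (by norm_num),
    Real.log_rpow hapos]
  have tangent : ∀ x x₀ : ℝ, 0 < x → 0 < x₀ → Real.log x ≤ Real.log x₀ + x / x₀ - 1 := by
    intro x x₀ hx hx₀
    have := Real.log_le_sub_one_of_pos (div_pos hx hx₀)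
    rw [Real.log_div hx.ne' hx₀.ne'] at this
    linarith
  have h2 := Real.log_two_gt_d9
  have h2' := Real.log_two_lt_d9
  have h3 := Real.log_three_gt_d9
  have h3' := Real.log_three_lt_d9
  have e1 : Real.log (2/3) = Real.log 2 - Real.log 3 := Real.log_div (by norm_num) (by norm_num)
  have e2 : Real.log (9/8) = 2 * Real.log 3 - 3 * Real.log 2 := by
    rw [show (9/8 : ℝ) = 3 ^ 2 / 2 ^ 3 by norm_num, Real.log_div (by norm_num) (by norm_num),
      Real.log_pow, Real.log_pow]
    norm_num
  have e3 : Real.log (729/512) = 6 * Real.log 3 - 9 * Real.log 2 := by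
    rw [show (729/512 : ℝ) = 3 ^ 6 / 2 ^ 9 by norm_num, Real.log_div (by norm_num) (by norm_num),
      Real.log_pow, Real.log_pow]
    norm_num
  have e4 : Real.log (19683/8192) = 9 * Real.log 3 - 13 * Real.log 2 := by
    rw [show (19683/8192 : ℝ) = 3 ^ 9 / 2 ^ 13 by norm_num,
      Real.log_div (by norm_num) (by norm_num), Real.log_pow, Real.log_pow]
    norm_num
  have e5 : Real.log (9/16) = 2 * Real.log 3 - 4 * Real.log 2 := by
    rw [show (9/16 : ℝ) = 3 ^ 2 / 2 ^ 4 by norm_num, Real.log_div (by norm_num) (by norm_num),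
      Real.log_pow, Real.log_pow]
    norm_num
  have t1 := tangent (1 + α) (729/512) (by linarith) (by norm_num)
  have t2 : -((1 - α) * Real.log (1 - α)) ≤ -((1 - α) * Real.log (9/16)) + (9/16 - (1 - α)) := by
    have h := mul_le_mul_of_nonneg_left (tangent (9/16) (1 - α) (by norm_num) hγ) hγ.le
    have hd : (1 - α) * (9/16 / (1 - α)) = 9/16 := by field_simp
    linarith
  have t3 : -(α * Real.log (2 + α)) ≤
      -(α * (Real.log (19683/8192) + 1)) + 19683/8192 * (1/6 + 25/72 * (α - 2/5)) := by
    have h := mul_le_mul_of_nonneg_left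
      (tangent (19683/8192) (2 + α) (by norm_num) (by linarith)) hα0.le
    have hd : α / (2 + α) ≤ 1/6 + 25/72 * (α - 2/5) := by
      rw [div_le_iff₀ (by linarith)]
      nlinarith [sq_nonneg (α - 2/5)]
    have he : α * (19683/8192 / (2 + α)) = 19683/8192 * (α / (2 + α)) := by ring
    linarith
  have hA := mul_le_mul_of_nonneg_left hloga hα0.le
  have b1 : Real.log (729/512) ≤ 0.353350 := by linarith
  have b2 : (1 - α) * (Real.log (2/3) - Real.log (9/16)) ≤ (1 - α) * 0.169901 :=
    mul_le_mul_of_nonneg_left (by linarith) hγ.le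
  have b3 : α * (Real.log (9/8) - Real.log (19683/8192) - 1) ≤ α * (-1.75881) :=
    mul_le_mul_of_nonneg_left (by linarith) hα0.le
  have b4 : α * α * 0.693147 ≤ α * α * Real.log 2 :=
    mul_le_mul_of_nonneg_left (by linarith) (by positivity)
  nlinarith [sq_nonneg (α - 21/50)]

lemma rpow_one_add_excess_gain {α β y : ℝ} (hα1 : α < 1) (hβ : 0 < β) (hβα : β ≤ α)
    (hy : y ∈ Icc (0:ℝ) (2/3)) :
    9 / (8 * (1 - α)) * y ^ (1 - α) + 3/8 * (y * (1 + excess β y)) ≤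
      9 / (8 * (1 - α)) * (y * (1 + excess β y)) ^ (1 - α) := by
  have hγ : 0 < 1 - α := by linarith
  rcases hy.1.eq_or_lt with rfl | hy0
  · simp
  have hu := excess_nonneg (β := β) hy.1
  have hu2 := excess_le hβ hy
  set u := excess β y with hu_def
  rw [Real.mul_rpow hy.1 (by linarith)]
  have hconc : 1 + 2 * u * ((3/2 : ℝ) ^ (1 - α) - 1) ≤ (1 + u) ^ (1 - α) := by
    have hcc := Real.concaveOn_rpow hγ.le (by linarith : 1 - α ≤ 1)
    have := hcc.2 (show (1:ℝ) ∈ Ici 0 by simp) (show (3/2:ℝ) ∈ Ici 0 by norm_num [mem_Ici])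
      (show 0 ≤ 1 - 2 * u by linarith) (show 0 ≤ 2 * u by linarith) (by ring)
    simp only [smul_eq_mul, Real.one_rpow] at this
    rw [show (1 - 2 * u) * 1 + 2 * u * (3/2) = 1 + u by ring] at this
    linarith
  have hpow : (3/2 : ℝ) * (2/3 : ℝ) ^ α * (1 - α) ≤ 3 * ((3/2 : ℝ) ^ (1 - α) - 1) := by
    have h1 : (2/3 : ℝ) ^ (1 - α) ≤ 1 - (1 - α) / 3 := by
      have := rpow_one_add_le_one_add_mul_self (s := -(1/3 : ℝ)) (by norm_num) hγ.le
        (by linarith)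
      norm_num at this
      linarith
    have h2 : (3/2 : ℝ) ^ (1 - α) * (2/3 : ℝ) ^ (1 - α) = 1 := by
      rw [← Real.mul_rpow (by norm_num) (by norm_num)]; norm_num
    have h3 : (3/2 : ℝ) ^ (1 - α) = 3/2 * (2/3 : ℝ) ^ α := by
      rw [Real.rpow_sub (by norm_num), Real.rpow_one, div_eq_mul_inv,
        ← Real.inv_rpow (by norm_num)]
      norm_num
    have h4 : 0 < (3/2 : ℝ) ^ (1 - α) := by positivity
    rw [← h3]
    nlinarith
  have hyα : y ^ α ≤ (2/3 : ℝ) ^ α * (2 * u) := by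
    have h1 : (2:ℝ) * u = (3 * y / 2) ^ β := by rw [hu_def, excess]; ring
    have h2 : y ^ α = (2/3 : ℝ) ^ α * (3 * y / 2) ^ α := by
      rw [← Real.mul_rpow (by norm_num) (by linarith)]
      congr 1; ring
    rw [h1, h2]
    exact mul_le_mul_of_nonneg_left
      (Real.rpow_le_rpow_of_exponent_ge (by linarith) (by linarith [hy.2]) hβα) (by positivity)
  have hsplit : y = y ^ (1 - α) * y ^ α := by
    rw [← Real.rpow_add hy0]; simp
  have hyγ : 0 < y ^ (1 - α) := Real.rpow_pos_of_pos hy0 _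
  have hmain : 3/8 * (y ^ α * (1 + u)) ≤ 9 / (8 * (1 - α)) * ((1 + u) ^ (1 - α) - 1) := by
    calc 3/8 * (y ^ α * (1 + u)) ≤ 3/8 * ((2/3 : ℝ) ^ α * (2 * u) * (3/2)) := by
          have := mul_le_mul hyα (show 1 + u ≤ 3/2 by linarith) (by linarith) (by positivity)
          linarith
      _ = 9 / (8 * (1 - α)) * (2 * u) * ((3/2 : ℝ) * (2/3 : ℝ) ^ α * (1 - α) / 3) := by
          field_simp
          ring
      _ ≤ 9 / (8 * (1 - α)) * (2 * u) * ((3/2 : ℝ) ^ (1 - α) - 1) :=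
          mul_le_mul_of_nonneg_left (by linarith) (by positivity)
      _ ≤ 9 / (8 * (1 - α)) * ((1 + u) ^ (1 - α) - 1) := by
          rw [mul_assoc]
          exact mul_le_mul_of_nonneg_left (by linarith) (by positivity)
  have h := mul_le_mul_of_nonneg_left hmain hyγ.le
  have he : 3/8 * (y * (1 + u)) = y ^ (1 - α) * (3/8 * (y ^ α * (1 + u))) := by
    conv_lhs => rw [hsplit]
    ring
  rw [he]
  linarith

/-- Probability densities on `[0,1]` in the invariant cone, with mass of `[0,t]` of order
`t ^ (1 - α)` and with value at least `K` at `1`. -/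
structure ConeDensity (α K : ℝ) (f : ℝ → ℝ) : Prop where
  antitoneOn : AntitoneOn f (Icc 0 1)
  nonneg : ∀ x ∈ Icc (0:ℝ) 1, 0 ≤ f x
  weight_monotoneOn : MonotoneOn (fun x => x ^ (1 + α) * f x) (Icc 0 1)
  integral_eq_one : ∫ x in (0:ℝ)..1, f x = 1
  integral_le : ∀ t ∈ Icc (0:ℝ) 1, ∫ x in (0:ℝ)..t, f x ≤ 9 / (8 * (1 - α)) * t ^ (1 - α)
  lower_bound : K ≤ f 1

namespace ConeDensity

variable {α K : ℝ} {f : ℝ → ℝ}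

lemma intervalIntegrable (h : ConeDensity α K f) {s t : ℝ} (hs : s ∈ Icc (0:ℝ) 1)
    (ht : t ∈ Icc (0:ℝ) 1) : IntervalIntegrable f volume s t :=
  intervalIntegrable_of_antitoneOn h.antitoneOn hs ht

lemma integral_le_mul (h : ConeDensity α K f) {s t : ℝ} (hs : s ∈ Icc (0:ℝ) 1)
    (ht : t ∈ Icc (0:ℝ) 1) (hst : s ≤ t) : ∫ x in s..t, f x ≤ (t - s) * f s := by
  have := intervalIntegral.integral_mono_on hst (h.intervalIntegrable hs ht)
    (intervalIntegrable_const (c := f s))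
    (fun x hx => h.antitoneOn hs ⟨hs.1.trans hx.1, hx.2.trans ht.2⟩ hx.1)
  simpa using this

lemma mul_le_integral (h : ConeDensity α K f) {s t : ℝ} (hs : s ∈ Icc (0:ℝ) 1)
    (ht : t ∈ Icc (0:ℝ) 1) (hst : s ≤ t) : (t - s) * f t ≤ ∫ x in s..t, f x := by
  have := intervalIntegral.integral_mono_on hst (intervalIntegrable_const (c := f t))
    (h.intervalIntegrable hs ht)
    (fun x hx => h.antitoneOn ⟨hs.1.trans hx.1, hx.2.trans ht.2⟩ ht hx.2)
  simpa using this

lemma apply_two_thirds_le (h : ConeDensity α K f) (hα0 : 0 < α) (hα1 : α < 1) :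
    f (2/3) ≤ 9/8 := by
  have m0 : (0:ℝ) ∈ Icc (0:ℝ) 1 := by norm_num
  have m1 : (1:ℝ) ∈ Icc (0:ℝ) 1 := by norm_num
  have m2 : (2/3:ℝ) ∈ Icc (0:ℝ) 1 := by norm_num
  have hL := h.nonneg _ m2
  have h1 := h.mul_le_integral m0 m2 (by norm_num)
  have hz : (0:ℝ) ∉ uIcc (2/3:ℝ) 1 := by
    rw [uIcc_of_le (by norm_num)]; norm_num
  have hpt : ∀ x ∈ Icc (2/3:ℝ) 1, 4/9 * f (2/3) * x ^ (-2:ℤ) ≤ f x := by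
    intro x hx
    have hx0 : 0 < x := by linarith [hx.1]
    have hw := h.weight_monotoneOn m2 ⟨hx0.le, hx.2⟩ hx.1
    simp only at hw
    have hr : (2/3 / x) ^ (2:ℝ) ≤ (2/3 / x) ^ (1 + α) :=
      Real.rpow_le_rpow_of_exponent_ge (by positivity) ((div_le_one hx0).2 hx.1) (by linarith)
    rw [Real.div_rpow (by norm_num) hx0.le (1 + α), Real.rpow_two] at hr
    have hxp := Real.rpow_pos_of_pos hx0 (1 + α)
    calc 4/9 * f (2/3) * x ^ (-2:ℤ) = (2/3 / x) ^ 2 * f (2/3) := by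
          rw [zpow_neg, div_pow]; norm_cast; field_simp; ring
      _ ≤ (2/3 : ℝ) ^ (1 + α) / x ^ (1 + α) * f (2/3) := mul_le_mul_of_nonneg_right hr hL
      _ ≤ f x := by
          rw [div_mul_eq_mul_div, div_le_iff₀ hxp]
          linarith
  have h2 := intervalIntegral.integral_mono_on (μ := volume) (show (2/3:ℝ) ≤ 1 by norm_num)
    ((intervalIntegral.intervalIntegrable_zpow (Or.inr hz)).const_mul _)
    (h.intervalIntegrable m2 m1) hpt
  rw [intervalIntegral.integral_const_mul, integral_zpow (Or.inr ⟨by norm_num, hz⟩)] at h2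
  have h3 := intervalIntegral.integral_add_adjacent_intervals (h.intervalIntegrable m0 m2)
    (h.intervalIntegrable m2 m1)
  rw [h.integral_eq_one] at h3
  norm_num at h2
  linarith

lemma integral_Pop_le (h : ConeDensity α K f) (hα0 : 0 < α) (hα1 : α < 1) {β : ℝ}
    (hβ : 0 < β) (hβα : β ≤ α) {t : ℝ} (ht : t ∈ Icc (0:ℝ) 1) :
    ∫ x in (0:ℝ)..t, Pop β f x ≤ 9 / (8 * (1 - α)) * t ^ (1 - α) := by
  obtain ⟨y, hy, rfl⟩ := exists_Tmap_eq hβ ht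
  rw [integral_Pop hβ h.antitoneOn h.nonneg hy]
  have h1 := h.integral_le y ⟨hy.1, by linarith [hy.2]⟩
  have h2 := h.integral_le_mul (s := 2/3) (t := (Tmap β y + 2) / 3) (by norm_num)
    ⟨by linarith [ht.1], by linarith [ht.2]⟩ (by linarith [ht.1])
  have h3 : ((Tmap β y + 2) / 3 - 2/3) * f (2/3) ≤ ((Tmap β y + 2) / 3 - 2/3) * (9/8) :=
    mul_le_mul_of_nonneg_left (h.apply_two_thirds_le hα0 hα1) (by linarith [ht.1])
  have h4 := rpow_one_add_excess_gain hα1 hβ hβα hy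
  rw [← Tmap_eq hβ hy] at h4
  linarith

lemma le_weight_two_thirds (h : ConeDensity α K f) (hα0 : 0 < α) (hα1 : α < 1)
    (hK0 : 0 < K) (hK1 : K ≤ 1)
    (hK : (2/3 * K) ^ (1 - α) * (9/8 : ℝ) ^ α ≤ α * (1 - α)) :
    2/3 * K ≤ (2/3 : ℝ) ^ (1 + α) * f (2/3) := by
  by_contra! hlt
  have hγ : 0 < 1 - α := by linarith
  set C := 2/3 * K with hC
  have hC0 : 0 < C := by positivity
  set t := C / (9/8) with ht
  have ht0 : 0 < t := by positivity
  have ht2 : t ≤ 2/3 := by rw [ht, div_le_iff₀ (by norm_num)]; linarith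
  have m0 : (0:ℝ) ∈ Icc (0:ℝ) 1 := by norm_num
  have m1 : (1:ℝ) ∈ Icc (0:ℝ) 1 := by norm_num
  have m2 : (2/3:ℝ) ∈ Icc (0:ℝ) 1 := by norm_num
  have mt : t ∈ Icc (0:ℝ) 1 := ⟨ht0.le, by linarith⟩
  have hz : (0:ℝ) ∉ uIcc t (2/3:ℝ) := by
    rw [uIcc_of_le ht2]; exact fun hz => absurd hz.1 (by linarith)
  have i1 := h.integral_le t mt
  have i2 := intervalIntegral.integral_mono_on (μ := volume) ht2 (h.intervalIntegrable mt m2)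
    ((intervalIntegral.intervalIntegrable_rpow (r := -(1 + α)) (Or.inr hz)).const_mul C)
    (fun x hx => by
      have hx0 : 0 < x := ht0.trans_le hx.1
      have hw := h.weight_monotoneOn ⟨hx0.le, by linarith [hx.2]⟩ m2 hx.2
      simp only at hw
      rw [Real.rpow_neg hx0.le, ← div_eq_mul_inv, le_div_iff₀ (Real.rpow_pos_of_pos hx0 _)]
      linarith)
  rw [intervalIntegral.integral_const_mul, integral_rpow (Or.inr ⟨by linarith, hz⟩)] at i2
  have i3 := h.integral_le_mul m2 m1 (by norm_num)
  have hsum1 := intervalIntegral.integral_add_adjacent_intervals (h.intervalIntegrable m0 mt)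
    (h.intervalIntegrable mt m2)
  have hsum2 := intervalIntegral.integral_add_adjacent_intervals (h.intervalIntegrable m0 m2)
    (h.intervalIntegrable m2 m1)
  rw [h.integral_eq_one] at hsum2
  rw [show -(1 + α) + 1 = -α by ring] at i2
  have hp : (2/3 : ℝ) ^ (1 + α) * (2/3 : ℝ) ^ (-α) = 2/3 := by
    rw [← Real.rpow_add (by norm_num)]; simp
  have hq : 1 ≤ (2/3 : ℝ) ^ (-α) :=
    Real.one_le_rpow_of_pos_of_le_one_of_nonpos (by norm_num) (by norm_num) (by linarith)
  set q := (2/3 : ℝ) ^ (-α)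
  have hL : f (2/3) < C * q * (3/2) := by
    have := mul_lt_mul_of_pos_right hlt (by linarith : 0 < q)
    have he : (2/3 : ℝ) ^ (1 + α) * f (2/3) * q = 2/3 * f (2/3) := by
      rw [mul_right_comm, hp]
    linarith
  have hmass : 9 / (8 * (1 - α)) * t ^ (1 - α) = C ^ (1 - α) * (9/8 : ℝ) ^ α / (1 - α) := by
    have h98 : (9/8 : ℝ) ^ (1 - α) = 9/8 / (9/8 : ℝ) ^ α := by
      rw [Real.rpow_sub (by norm_num), Real.rpow_one]
    rw [ht, Real.div_rpow hC0.le (by norm_num), h98]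
    field_simp
  have htail : C * t ^ (-α) = C ^ (1 - α) * (9/8 : ℝ) ^ α := by
    rw [ht, Real.div_rpow hC0.le (by norm_num), Real.rpow_neg (by norm_num : (0:ℝ) ≤ 9/8),
      Real.rpow_neg hC0.le, Real.rpow_sub hC0, Real.rpow_one]
    field_simp
  set W := C ^ (1 - α) * (9/8 : ℝ) ^ α
  have hW : W / (1 - α) + W / α ≤ 1 := by
    rw [div_add_div _ _ hγ.ne' hα0.ne', div_le_one (by positivity)]
    linarith
  have hi2 : C * ((q - t ^ (-α)) / -α) = W / α - C * q / α := by
    rw [← htail]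
    field_simp
    ring
  rw [hi2] at i2
  rw [hmass] at i1
  have hCq : 0 < C * q := by positivity
  have hfin : C * q ≤ C * q / α := by
    rw [le_div_iff₀ hα0]
    nlinarith
  linarith

lemma le_Pop_one (h : ConeDensity α K f) (hα0 : 0 < α) (hα1 : α < 1)
    (hK0 : 0 < K) (hK1 : K ≤ 1)
    (hK : (2/3 * K) ^ (1 - α) * (9/8 : ℝ) ^ α ≤ α * (1 - α)) {β : ℝ}
    (hβ : 0 < β) (hβα : β ≤ α) : K ≤ Pop β f 1 := by
  have m2 : (2/3:ℝ) ∈ Icc (0:ℝ) 1 := by norm_num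
  have hL := h.nonneg _ m2
  have hw := h.le_weight_two_thirds hα0 hα1 hK0 hK1 hK
  have h1 := h.lower_bound
  rw [Pop, leftInv_one hβ, Tderiv_eq ⟨by norm_num, le_rfl⟩, excess_two_thirds,
    show ((1:ℝ) + 2) / 3 = 1 by norm_num]
  have hb : (2/3 : ℝ) ^ (1 + α) ≤ 1 / (1 + (1 + β) * (1/2)) := by
    have h2 := one_add_mul_self_le_rpow_one_add (s := (1/2 : ℝ)) (by norm_num)
      (p := 1 + β) (by linarith)
    calc (2/3 : ℝ) ^ (1 + α) ≤ (2/3 : ℝ) ^ (1 + β) :=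
          Real.rpow_le_rpow_of_exponent_ge (by norm_num) (by norm_num) (by linarith)
      _ = 1 / (1 + 1/2 : ℝ) ^ (1 + β) := by
          rw [one_div, ← Real.inv_rpow (by norm_num)]; norm_num
      _ ≤ _ := one_div_le_one_div_of_le (by positivity) h2
  have h3 := mul_le_mul_of_nonneg_right hb hL
  rw [one_div_mul_eq_div] at h3
  linarith

lemma pop (h : ConeDensity α K f) (hα0 : 0 < α) (hα1 : α < 1)
    (hK0 : 0 < K) (hK1 : K ≤ 1)
    (hK : (2/3 * K) ^ (1 - α) * (9/8 : ℝ) ^ α ≤ α * (1 - α)) {β : ℝ}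
    (hβ : 0 < β) (hβα : β ≤ α) : ConeDensity α K (Pop β f) where
  antitoneOn := Pop_antitoneOn hβ h.antitoneOn h.nonneg
  nonneg := Pop_nonneg hβ h.nonneg
  weight_monotoneOn := Pop_weight_monotoneOn hβ hβα h.nonneg h.weight_monotoneOn
  integral_eq_one := by
    have m0 : (0:ℝ) ∈ Icc (0:ℝ) 1 := by norm_num
    have m1 : (1:ℝ) ∈ Icc (0:ℝ) 1 := by norm_num
    have m2 : (2/3:ℝ) ∈ Icc (0:ℝ) 1 := by norm_num
    have := integral_Pop hβ h.antitoneOn h.nonneg (y := 2/3) ⟨by norm_num, le_rfl⟩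
    rw [Tmap_two_thirds hβ, show ((1:ℝ) + 2) / 3 = 1 by norm_num,
      intervalIntegral.integral_add_adjacent_intervals (h.intervalIntegrable m0 m2)
        (h.intervalIntegrable m2 m1), h.integral_eq_one] at this
    exact this
  integral_le := fun _ ht => h.integral_Pop_le hα0 hα1 hβ hβα ht
  lower_bound := h.le_Pop_one hα0 hα1 hK0 hK1 hK hβ hβα

lemma const_one (hα0 : 0 < α) (hα1 : α < 1) (hK1 : K ≤ 1) :
    ConeDensity α K (fun _ => 1) where
  antitoneOn := fun _ _ _ _ _ => le_rfl
  nonneg := fun _ _ => zero_le_one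
  weight_monotoneOn := fun x hx y _ hxy => by
    simpa using Real.rpow_le_rpow hx.1 hxy (by linarith)
  integral_eq_one := by simp
  integral_le := fun t ht => by
    have h1 : t ≤ t ^ (1 - α) := by
      simpa using Real.rpow_le_rpow_of_exponent_ge' ht.1 ht.2 (z := 1 - α) (by linarith)
        (show 1 - α ≤ 1 by linarith)
    have h2 : 1 ≤ 9 / (8 * (1 - α)) := by
      rw [one_le_div (by linarith)]; linarith
    simp only [intervalIntegral.integral_const, sub_zero, smul_eq_mul, mul_one]
    nlinarith [Real.rpow_nonneg ht.1 (1 - α)]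
  lower_bound := hK1

end ConeDensity

/-- For every `m ≥ 1`, every sequence `β₁, …, β_m ∈ (0,α]` and every
`x ∈ [0,1]` one has `(P_{β_m} ∘ ⋯ ∘ P_{β_1}) 1 (x) ≥ min {a, (α(1+α)/a^α)^(1/(1-α))}`. -/
theorem concatenation_on_one_lower_bound (α a : ℝ) (hα0 : 0 < α) (hα1 : α < 1)
    (ha : (2:ℝ)^α * (2+α) / (1-α) ≤ a)
    (m : ℕ) (hm : 1 ≤ m) (β : ℕ → ℝ)
    (hβ : ∀ i, 1 ≤ i → i ≤ m → β i ∈ Set.Ioc (0:ℝ) α)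
    (x : ℝ) (hx : x ∈ Set.Icc (0:ℝ) 1) :
    min a ((α*(1+α)/a^α)^(1/(1-α))) ≤ PopComp β m (fun _ => 1) x := by

  have hγ : 0 < 1 - α := by linarith
  have ha0 : 0 < (2:ℝ) ^ α * (2 + α) / (1 - α) := by positivity
  have hapos : 0 < a := ha0.trans_le ha
  have ha2 : 2 ≤ a := by
    refine le_trans ?_ ha
    rw [le_div_iff₀ hγ]
    nlinarith [Real.one_le_rpow (show (1:ℝ) ≤ 2 by norm_num) hα0.le]
  set K := (α * (1 + α) / a ^ α) ^ (1 / (1 - α)) with hKdef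
  have hbase : 0 < α * (1 + α) / a ^ α := by positivity
  have hK0 : 0 < K := Real.rpow_pos_of_pos hbase _
  have hKpow : K ^ (1 - α) = α * (1 + α) / a ^ α := by
    rw [hKdef, ← Real.rpow_mul hbase.le, one_div_mul_cancel hγ.ne', Real.rpow_one]
  have hK1 : K ≤ 1 := by
    refine Real.rpow_le_one hbase.le ?_ (by positivity)
    rw [div_le_one (by positivity)]
    have h1 : (2:ℝ) ^ α ≤ a ^ α := Real.rpow_le_rpow (by norm_num) ha2 hα0.le
    have h2 : (2:ℝ) ^ (1 - α) ≤ 2 - α := by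
      have := rpow_one_add_le_one_add_mul_self (s := (1:ℝ)) (by norm_num) hγ.le (by linarith)
      norm_num at this
      linarith
    have h3 : (2:ℝ) ^ (1 - α) * 2 ^ α = 2 := by
      rw [← Real.rpow_add (by norm_num)]; simp
    have h4 : 0 < (2:ℝ) ^ α := by positivity
    nlinarith [sq_nonneg (1 - α), mul_pos hα0 hγ]
  have hK : (2/3 * K) ^ (1 - α) * (9/8 : ℝ) ^ α ≤ α * (1 - α) := by
    rw [Real.mul_rpow (by norm_num) hK0.le, hKpow]
    have h := mul_rpow_le_mul_rpow hα0 hα1 ha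
    have hap : 0 < a ^ α := by positivity
    rw [show (2/3 : ℝ) ^ (1 - α) * (α * (1 + α) / a ^ α) * (9/8 : ℝ) ^ α
      = α * ((2/3 : ℝ) ^ (1 - α) * (1 + α) * (9/8 : ℝ) ^ α) / a ^ α by ring, div_le_iff₀ hap]
    nlinarith
  have hcone : ∀ n ≤ m, ConeDensity α K (PopComp β n fun _ => 1) := by
    intro n
    induction n with
    | zero => exact fun _ => ConeDensity.const_one hα0 hα1 hK1
    | succ n ih =>
      intro hn
      have hb := hβ (0 + n + 1) (by omega) (by omega)
      exact (ih (by omega)).pop hα0 hα1 hK0 hK1 hK hb.1 hb.2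
  have h := hcone m le_rfl
  exact (min_le_right _ _).trans
    (h.lower_bound.trans (h.antitoneOn hx ⟨zero_le_one, le_rfl⟩ hx.2))
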